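/- arXiv:1806.05589 — 6 statements merged into one kernel-verified Lean document; each statement's English description precedes it below -/
import Mathlib

section
/- Let 𝒳 and 𝒴 be nonempty finite sets, n ∈ ℕ₊, W ∈ 𝒫(𝒴|𝒳), α ∈ (0,1) and β ∈ (0, 1−α], and suppose q := (√(−ln β) + √(−ln α))/√(2n) ≤ 1/2. Then for every nonempty set A ⊆ 𝒳^n: 0 ≤ (1/n)·log₂( g^n_W(A, 1−β) / g^n_W(A, α) ) ≤ h₂(q) + q·log₂|𝒴|, where h₂(q) = −q·log₂ q − (1−q)·log₂(1−q) is the binary entropy function. -/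
open scoped Classical BigOperators

noncomputable section

namespace Paper

variable {Ω : Type*}

/-- Probability of an event under a discrete probability distribution. -/
def pr (μ : PMF Ω) (E : Set Ω) : ℝ := (μ.toOuterMeasure E).toReal

/-- Conditional probability `Pr(E | F)`. -/
def cpr (μ : PMF Ω) (E F : Set Ω) : ℝ := pr μ (E ∩ F) / pr μ F

/-- Entropy spectrum frequency `h_X(x) = -log₂ Pr(X = x)`. -/
def hs {α : Type*} (μ : PMF Ω) (X : Ω → α) (x : α) : ℝ :=
  - Real.logb 2 (pr μ {ω | X ω = x})

/-- Conditional entropy spectrum frequency `h_{X|Y}(x|y) = -log₂ Pr(X = x | Y = y)`. -/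
def hcs {α β : Type*} (μ : PMF Ω) (X : Ω → α) (Y : Ω → β) (x : α) (y : β) : ℝ :=
  - Real.logb 2 (cpr μ {ω | X ω = x} {ω | Y ω = y})

/-- Conditional Shannon entropy (bits) `H(X|Y)`. -/
def Hc {α β : Type*} [Fintype α] [Fintype β] (μ : PMF Ω) (X : Ω → α) (Y : Ω → β) : ℝ :=
  - ∑ x : α, ∑ y : β, pr μ ({ω | X ω = x} ∩ {ω | Y ω = y}) *
      Real.logb 2 (cpr μ {ω | X ω = x} {ω | Y ω = y})

/-- Shannon entropy (bits) of `X` conditioned on the event `E`. -/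
def HEvt {α : Type*} [Fintype α] (μ : PMF Ω) (X : Ω → α) (E : Set Ω) : ℝ :=
  - ∑ x : α, cpr μ {ω | X ω = x} E * Real.logb 2 (cpr μ {ω | X ω = x} E)

/-- Conditional Shannon entropy (bits) `H(X|Y)` computed given the event `E`. -/
def HcEvt {α β : Type*} [Fintype α] [Fintype β] (μ : PMF Ω) (X : Ω → α) (Y : Ω → β)
    (E : Set Ω) : ℝ :=
  - ∑ x : α, ∑ y : β, cpr μ ({ω | X ω = x} ∩ {ω | Y ω = y}) E *
      Real.logb 2 (cpr μ {ω | X ω = x} ({ω | Y ω = y} ∩ E))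

/-- `A ⊸ B ⊸ C` : `A` and `C` are conditionally independent given `B`. -/
def Markov {α β γ : Type*} (μ : PMF Ω) (A : Ω → α) (B : Ω → β) (C : Ω → γ) : Prop :=
  ∀ a b c, pr μ {ω | A ω = a ∧ B ω = b ∧ C ω = c} * pr μ {ω | B ω = b} =
    pr μ {ω | A ω = a ∧ B ω = b} * pr μ {ω | B ω = b ∧ C ω = c}

/-- A discrete memoryless channel from `𝒳` to `𝒴`. -/
structure Channel (𝒳 𝒴 : Type*) [Fintype 𝒴] where
  w : 𝒳 → 𝒴 → ℝ
  nonneg : ∀ x y, 0 ≤ w x y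
  sum_one : ∀ x, ∑ y, w x y = 1

/-- The `n`-fold product channel `W^n(𝐲|𝐱)`. -/
def Channel.pn {𝒳 𝒴 : Type*} [Fintype 𝒴] (W : Channel 𝒳 𝒴) (n : ℕ)
    (x : Fin n → 𝒳) (y : Fin n → 𝒴) : ℝ := ∏ i, W.w (x i) (y i)

/-- `Y` is an output of `X` through `W^n`. -/
def IsOutput {𝒳 𝒴 : Type*} [Fintype 𝒴] {n : ℕ} (μ : PMF Ω)
    (X : Ω → Fin n → 𝒳) (Y : Ω → Fin n → 𝒴) (W : Channel 𝒳 𝒴) : Prop :=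
  ∀ x y, 0 < pr μ {ω | X ω = x} → cpr μ {ω | Y ω = y} {ω | X ω = x} = W.pn n x y

/-- `W^n(B|𝐱)`. -/
def imgMass {𝒳 𝒴 : Type*} [Fintype 𝒴] (W : Channel 𝒳 𝒴) (n : ℕ)
    (x : Fin n → 𝒳) (B : Finset (Fin n → 𝒴)) : ℝ := ∑ y ∈ B, W.pn n x y

/-- `B` is an `η`-image of `A` by `W`. -/
def IsImage {𝒳 𝒴 : Type*} [Fintype 𝒴] (W : Channel 𝒳 𝒴) (n : ℕ)
    (A : Set (Fin n → 𝒳)) (η : ℝ) (B : Finset (Fin n → 𝒴)) : Prop :=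
  ∀ x ∈ A, η ≤ imgMass W n x B

/-- Minimum cardinality of an `η`-image of `A` by `W`. -/
def gimg {𝒳 𝒴 : Type*} [Fintype 𝒴] (W : Channel 𝒳 𝒴) (n : ℕ)
    (A : Set (Fin n → 𝒳)) (η : ℝ) : ℕ :=
  sInf {k | ∃ B : Finset (Fin n → 𝒴), IsImage W n A η B ∧ B.card = k}

/-- `B` is an `η`-quasi-image of the pmf `P` by `W`. -/
def IsQImage {𝒳 𝒴 : Type*} [Fintype 𝒳] [Fintype 𝒴] (W : Channel 𝒳 𝒴) (n : ℕ)
    (P : (Fin n → 𝒳) → ℝ) (η : ℝ) (B : Finset (Fin n → 𝒴)) : Prop :=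
  η ≤ ∑ x, imgMass W n x B * P x

/-- Minimum cardinality of an `η`-quasi-image of `P` by `W`. -/
def gqimg {𝒳 𝒴 : Type*} [Fintype 𝒳] [Fintype 𝒴] (W : Channel 𝒳 𝒴) (n : ℕ)
    (P : (Fin n → 𝒳) → ℝ) (η : ℝ) : ℕ :=
  sInf {k | ∃ B : Finset (Fin n → 𝒴), IsQImage W n P η B ∧ B.card = k}

/-- The number of values in the support of `U`. -/
def suppCard {α : Type*} [Fintype α] (μ : PMF Ω) (U : Ω → α) : ℕ :=
  (Finset.univ.filter (fun u => 0 < pr μ {ω | U ω = u})).card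

/-- Mutual information (bits). -/
def MI {α β : Type*} [Fintype α] [Fintype β] (μ : PMF Ω) (A : Ω → α) (B : Ω → β) : ℝ :=
  ∑ a : α, ∑ b : β, pr μ {ω | A ω = a ∧ B ω = b} *
    Real.logb 2 (pr μ {ω | A ω = a ∧ B ω = b} / (pr μ {ω | A ω = a} * pr μ {ω | B ω = b}))

/-- Conditional mutual information (bits). -/
def CMI {α β γ : Type*} [Fintype α] [Fintype β] [Fintype γ] (μ : PMF Ω)
    (A : Ω → α) (B : Ω → β) (C : Ω → γ) : ℝ :=
  ∑ c : γ, pr μ {ω | C ω = c} * ∑ a : α, ∑ b : β,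
    cpr μ {ω | A ω = a ∧ B ω = b} {ω | C ω = c} *
      Real.logb 2 (cpr μ {ω | A ω = a ∧ B ω = b} {ω | C ω = c} /
        (cpr μ {ω | A ω = a} {ω | C ω = c} * cpr μ {ω | B ω = b} {ω | C ω = c}))

/-- `D_{wh}(w‖w'|p̂)` in the extended reals, with the stated conventions. -/
def Dkl {𝒳 𝒴 : Type*} [Fintype 𝒳] [Fintype 𝒴] (w w' wh : Channel 𝒳 𝒴)
    (p : 𝒳 → ℝ) : EReal :=
  if ∃ x y, 0 < wh.w x y * p x ∧ w'.w x y = 0 ∧ 0 < w.w x y then ⊤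
  else if ∃ x y, 0 < wh.w x y * p x ∧ w.w x y = 0 ∧ 0 < w'.w x y then ⊥
  else ((∑ x : 𝒳, ∑ y : 𝒴, wh.w x y * p x * Real.logb 2 (w.w x y / w'.w x y) : ℝ) : EReal)

/-- `sup { D_{wh}(w‖w'|p̂) }` over channels `wh` and pmfs `p̂` on `𝒳`. -/
def DklSup {𝒳 𝒴 : Type*} [Fintype 𝒳] [Fintype 𝒴] (w w' : Channel 𝒳 𝒴) : EReal :=
  sSup {d : EReal | ∃ (wh : Channel 𝒳 𝒴) (p : 𝒳 → ℝ),
    (∀ x, 0 ≤ p x) ∧ (∑ x, p x = 1) ∧ d = Dkl w w' wh p}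


/-- Hoeffding's lemma for a probability vector on a finite type. -/
lemma sum_mul_exp_le_of_oscillation_le_one {Y : Type*} [Fintype Y] (p g : Y → ℝ)
    (hp : ∀ y, 0 ≤ p y) (hs : ∑ y, p y = 1) (hg : ∀ y y', g y - g y' ≤ 1) (t : ℝ) :
    ∑ y, p y * Real.exp (t * g y) ≤ Real.exp (t * ∑ y, p y * g y + t ^ 2 / 8) := by
  have hne : Nonempty Y := by
    by_contra h
    rw [not_nonempty_iff] at h
    simp at hs
  let _ : MeasurableSpace Y := ⊤
  have hsum : ∑ y, ENNReal.ofReal (p y) = 1 := by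
    rw [← ENNReal.ofReal_sum_of_nonneg (fun y _ => hp y), hs, ENNReal.ofReal_one]
  let P : PMF Y := PMF.ofFintype (fun y => ENNReal.ofReal (p y)) hsum
  have hint (f : Y → ℝ) : ∫ y, f y ∂P.toMeasure = ∑ y, p y * f y := by
    rw [PMF.integral_eq_sum]
    simp [P, ENNReal.toReal_ofReal (hp _)]
  obtain ⟨y₀, hy₀⟩ := Finite.exists_min g
  have hmem : ∀ y, g y ∈ Set.Icc (g y₀) (g y₀ + 1) :=
    fun y => ⟨hy₀ y, by linarith [hg y y₀]⟩
  have key := (ProbabilityTheory.hasSubgaussianMGF_of_mem_Icc (μ := P.toMeasure) (X := g)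
    (a := g y₀) (b := g y₀ + 1) (measurable_of_finite _).aemeasurable
    (Filter.Eventually.of_forall hmem)).mgf_le t
  rw [ProbabilityTheory.mgf, hint g, hint] at key
  have hc : (((‖g y₀ + 1 - g y₀‖₊ / 2) ^ 2 : NNReal) : ℝ) * t ^ 2 / 2 = t ^ 2 / 8 := by
    push_cast
    rw [add_sub_cancel_left, norm_one]
    ring
  rw [hc] at key
  set m := ∑ y, p y * g y
  calc ∑ y, p y * Real.exp (t * g y)
      = Real.exp (t * m) * ∑ y, p y * Real.exp (t * (g y - m)) := by
        rw [Finset.mul_sum]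
        refine Finset.sum_congr rfl fun y _ => ?_
        rw [mul_left_comm, ← Real.exp_add]
        ring_nf
    _ ≤ Real.exp (t * m) * Real.exp (t ^ 2 / 8) := by gcongr
    _ = _ := by rw [← Real.exp_add]

lemma sum_prod_mul_cons {Y : Type*} [Fintype Y] {n : ℕ} (p : Fin (n + 1) → Y → ℝ)
    (F : (Fin (n + 1) → Y) → ℝ) :
    ∑ y, (∏ i, p i (y i)) * F y =
      ∑ a, p 0 a * ∑ z : Fin n → Y, (∏ i, p i.succ (z i)) * F (Fin.cons a z) := by
  rw [← (Fin.consEquiv fun _ => Y).sum_comp, Fintype.sum_prod_type]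
  refine Finset.sum_congr rfl fun a _ => ?_
  rw [Finset.mul_sum]
  refine Finset.sum_congr rfl fun z _ => ?_
  simp [Fin.consEquiv, Fin.prod_univ_succ, mul_assoc]

lemma sum_prod_eq_one {Y : Type*} [Fintype Y] {n : ℕ} (p : Fin n → Y → ℝ)
    (hs : ∀ i, ∑ y, p i y = 1) : ∑ y : Fin n → Y, ∏ i, p i (y i) = 1 := by
  rw [← Fintype.prod_sum]
  simp [hs]

lemma hammingDist_cons {Y : Type*} {n : ℕ} (a b : Y) (y z : Fin n → Y) :
    hammingDist (Fin.cons a y : Fin (n + 1) → Y) (Fin.cons b z : Fin (n + 1) → Y) =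
      (if a = b then 0 else 1) + hammingDist y z := by
  simp only [hammingDist, Finset.card_filter, Fin.sum_univ_succ, Fin.cons_zero, Fin.cons_succ]
  split_ifs <;> simp_all

/-- The moment generating function of a function that is `1`-Lipschitz for the Hamming distance,
under a product distribution. -/
lemma sum_prod_mul_exp_le_of_hammingLipschitz {Y : Type*} [Fintype Y] (t : ℝ) :
    ∀ (n : ℕ) (p : Fin n → Y → ℝ) (_ : ∀ i y, 0 ≤ p i y) (_ : ∀ i, ∑ y, p i y = 1)
      (f : (Fin n → Y) → ℝ) (_ : ∀ y y', f y - f y' ≤ hammingDist y y'),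
      ∑ y, (∏ i, p i (y i)) * Real.exp (t * f y) ≤
        Real.exp (t * ∑ y, (∏ i, p i (y i)) * f y + n * t ^ 2 / 8) := by
  intro n
  induction n with
  | zero =>
    intro p _ _ f _
    simp
  | succ n ih =>
    intro p hp hs f hf
    rw [sum_prod_mul_cons p fun y => Real.exp (t * f y), sum_prod_mul_cons p f]
    set g : Y → ℝ := fun a => ∑ z : Fin n → Y, (∏ i, p i.succ (z i)) * f (Fin.cons a z) with hgdef
    have hone : ∑ z : Fin n → Y, ∏ i, p i.succ (z i) = 1 :=
      sum_prod_eq_one (fun i : Fin n => p i.succ) fun i => hs i.succ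
    have hg : ∀ a b, g a - g b ≤ 1 := by
      intro a b
      rw [hgdef]
      simp only
      rw [← Finset.sum_sub_distrib, ← hone]
      refine Finset.sum_le_sum fun z _ => ?_
      rw [← mul_sub]
      refine mul_le_of_le_one_right (Finset.prod_nonneg fun i _ => hp _ _) ?_
      refine (hf _ _).trans ?_
      rw [hammingDist_cons, hammingDist_self]
      split_ifs <;> simp
    calc ∑ a, p 0 a * ∑ z : Fin n → Y, (∏ i, p i.succ (z i)) * Real.exp (t * f (Fin.cons a z))
        ≤ ∑ a, p 0 a * Real.exp (t * g a + n * t ^ 2 / 8) := by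
          refine Finset.sum_le_sum fun a _ => mul_le_mul_of_nonneg_left ?_ (hp 0 a)
          refine ih (fun i => p i.succ) (fun i => hp i.succ) (fun i => hs i.succ)
            (fun z => f (Fin.cons a z)) fun y y' => ?_
          refine (hf _ _).trans ?_
          rw [hammingDist_cons]
          simp
      _ = (∑ a, p 0 a * Real.exp (t * g a)) * Real.exp (n * t ^ 2 / 8) := by
          rw [Finset.sum_mul]
          refine Finset.sum_congr rfl fun a _ => ?_
          rw [Real.exp_add, mul_assoc]
      _ ≤ Real.exp (t * ∑ a, p 0 a * g a + t ^ 2 / 8) * Real.exp (n * t ^ 2 / 8) := by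
          gcongr
          exact sum_mul_exp_le_of_oscillation_le_one (p 0) g (hp 0) (hs 0) hg t
      _ = _ := by
          rw [← Real.exp_add, hgdef]
          push_cast
          ring_nf

/-- The Hamming neighbourhood of radius `l` of `B`. -/
def hammingNbhd {Y : Type*} [Fintype Y] {n : ℕ} (B : Finset (Fin n → Y)) (l : ℕ) :
    Finset (Fin n → Y) :=
  Finset.univ.filter fun y => ∃ b ∈ B, hammingDist y b ≤ l

/-- The sub-Gaussian tail bound, one event at a time. -/
lemma sq_le_of_forall_mul_exp_le {n P s : ℝ} (hn : 0 < n) (hP : 0 < P)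
    (h : ∀ t, 0 ≤ t → P * Real.exp (t * s) ≤ Real.exp (n * t ^ 2 / 8)) :
    s ≤ Real.sqrt (n / 2) * Real.sqrt (-Real.log P) := by
  rcases le_or_gt s 0 with hs | hs
  · exact hs.trans (by positivity)
  have h1 := h (4 * s / n) (by positivity)
  have h2 := Real.log_le_log (by positivity) h1
  rw [Real.log_mul hP.ne' (Real.exp_ne_zero _), Real.log_exp, Real.log_exp] at h2
  rw [← Real.sqrt_mul (by positivity)]
  refine Real.le_sqrt_of_sq_le ?_
  have h3 : n * (4 * s / n) ^ 2 / 8 = 2 * s ^ 2 / n := by field_simp; ring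
  have h4 : 4 * s / n * s = 4 * s ^ 2 / n := by ring
  rw [h3, h4] at h2
  have h5 : 2 * s ^ 2 / n ≤ -Real.log P := by
    have : 4 * s ^ 2 / n = 2 * s ^ 2 / n + 2 * s ^ 2 / n := by ring
    linarith
  rw [div_le_iff₀ hn] at h5
  linarith

/-- Blowing-up lemma for product distributions. -/
lemma blowing_up {Y : Type*} [Fintype Y] {n : ℕ} (hn : 0 < n) (p : Fin n → Y → ℝ)
    (hp : ∀ i y, 0 ≤ p i y) (hs : ∀ i, ∑ y, p i y = 1) (B : Finset (Fin n → Y)) {α β : ℝ}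
    (hα : 0 < α) (hβ : 0 < β) (hB : α ≤ ∑ y ∈ B, ∏ i, p i (y i)) (l : ℕ)
    (hl : Real.sqrt (n / 2) * Real.sqrt (-Real.log β) +
      Real.sqrt (n / 2) * Real.sqrt (-Real.log α) < l + 1) :
    1 - β ≤ ∑ y ∈ hammingNbhd B l, ∏ i, p i (y i) := by
  have hn' : (0 : ℝ) < n := by exact_mod_cast hn
  have hBne : B.Nonempty := by
    by_contra h
    rw [Finset.not_nonempty_iff_eq_empty] at h
    rw [h, Finset.sum_empty] at hB
    linarith
  set P : (Fin n → Y) → ℝ := fun y => ∏ i, p i (y i) with hPdef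
  have hP0 : ∀ y, 0 ≤ P y := fun y => Finset.prod_nonneg fun i _ => hp _ _
  have hP1 : ∑ y, P y = 1 := sum_prod_eq_one p hs
  set f : (Fin n → Y) → ℝ := fun y => ((B.inf' hBne fun b => hammingDist y b : ℕ) : ℝ) with hfdef
  have hf : ∀ y y', f y - f y' ≤ hammingDist y y' := by
    intro y y'
    obtain ⟨b, hb, hb'⟩ := B.exists_mem_eq_inf' hBne fun b => hammingDist y' b
    rw [hfdef]
    simp only
    rw [hb', sub_le_iff_le_add]
    exact_mod_cast (Finset.inf'_le _ hb).trans (hammingDist_triangle y y' b)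
  have hfB : ∀ y ∈ B, f y = 0 := by
    intro y hy
    rw [hfdef]
    simp only [Nat.cast_eq_zero]
    exact Nat.le_zero.mp ((Finset.inf'_le _ hy).trans (hammingDist_self y).le)
  have hfC : ∀ y ∉ hammingNbhd B l, (l + 1 : ℝ) ≤ f y := by
    intro y hy
    obtain ⟨b, hb, hb'⟩ := B.exists_mem_eq_inf' hBne fun b => hammingDist y b
    rw [hfdef]
    simp only
    rw [hb']
    simp only [hammingNbhd, Finset.mem_filter, Finset.mem_univ, true_and, not_exists, not_and,
      not_le] at hy
    exact_mod_cast hy b hb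
  set m := ∑ y, P y * f y
  have hmgf : ∀ t, ∑ y, P y * Real.exp (t * f y) ≤ Real.exp (t * m + n * t ^ 2 / 8) :=
    fun t => sum_prod_mul_exp_le_of_hammingLipschitz t n p hp hs f hf
  have hm : m ≤ Real.sqrt (n / 2) * Real.sqrt (-Real.log α) := by
    refine sq_le_of_forall_mul_exp_le hn' hα fun t _ => ?_
    have h1 : ∑ y ∈ B, P y ≤ Real.exp (-t * m + n * (-t) ^ 2 / 8) := by
      refine le_trans ?_ (hmgf (-t))
      refine le_trans (Finset.sum_le_sum fun y hy => ?_)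
        (Finset.sum_le_univ_sum_of_nonneg fun y => mul_nonneg (hP0 y) (Real.exp_nonneg _))
      simp [hfB y hy]
    calc α * Real.exp (t * m) ≤ Real.exp (-t * m + n * (-t) ^ 2 / 8) * Real.exp (t * m) := by
          gcongr
          exact hB.trans h1
      _ = _ := by rw [← Real.exp_add]; ring_nf
  by_contra hcon
  have hC : β ≤ ∑ y ∈ (hammingNbhd B l)ᶜ, P y := by
    have := Finset.sum_add_sum_compl (hammingNbhd B l) P
    rw [hP1] at this
    linarith
  have hL : (l + 1 - m : ℝ) ≤ Real.sqrt (n / 2) * Real.sqrt (-Real.log β) := by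
    refine sq_le_of_forall_mul_exp_le hn' hβ fun t ht => ?_
    have h1 : (∑ y ∈ (hammingNbhd B l)ᶜ, P y) * Real.exp (t * (l + 1)) ≤
        Real.exp (t * m + n * t ^ 2 / 8) := by
      refine le_trans ?_ (hmgf t)
      rw [Finset.sum_mul]
      refine le_trans (Finset.sum_le_sum fun y hy => ?_)
        (Finset.sum_le_univ_sum_of_nonneg fun y => mul_nonneg (hP0 y) (Real.exp_nonneg _))
      have := hfC y (Finset.mem_compl.mp hy)
      have := hP0 y
      gcongr
    calc β * Real.exp (t * (l + 1 - m))
        = β * Real.exp (t * (l + 1)) * Real.exp (-(t * m)) := by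
          rw [mul_assoc, ← Real.exp_add]
          ring_nf
      _ ≤ Real.exp (t * m + n * t ^ 2 / 8) * Real.exp (-(t * m)) := by
          gcongr
          refine le_trans ?_ h1
          gcongr
      _ = _ := by rw [← Real.exp_add]; ring_nf
  linarith

/-- The volume of a Hamming ball, bounded through the binary entropy (in nats). -/
lemma card_hammingBall_le {Y : Type*} [Fintype Y] [Nonempty Y] {n : ℕ} {q : ℝ} (hq : 0 < q)
    (hq2 : q ≤ 1 / 2) {l : ℕ} (hl : (l : ℝ) ≤ n * q) (b : Fin n → Y) :
    ((Finset.univ.filter fun y => hammingDist y b ≤ l).card : ℝ) ≤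
      Real.exp (n * (-q * Real.log q - (1 - q) * Real.log (1 - q) +
        q * Real.log (Fintype.card Y))) := by
  have hk : (1 : ℝ) ≤ Fintype.card Y := by exact_mod_cast Fintype.card_pos
  set k : ℝ := (Fintype.card Y : ℝ) with hkdef
  have hk0 : 0 < k := by linarith
  have hq1 : 0 < 1 - q := by linarith
  let w : Fin n → Y → ℝ := fun i y => if y = b i then 1 - q else q / k
  have hw0 : ∀ i y, 0 ≤ w i y := by
    intro i y
    simp only [w]
    split_ifs <;> positivity
  have hw1 : ∀ i, ∑ y, w i y ≤ 1 := by
    intro i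
    calc ∑ y, w i y ≤ ∑ y, ((if y = b i then 1 - q else 0) + q / k) := by
          refine Finset.sum_le_sum fun y _ => ?_
          simp only [w]
          have : 0 ≤ q / k := by positivity
          split_ifs <;> linarith
      _ = 1 := by
          rw [Finset.sum_add_distrib]
          simp only [Finset.sum_ite_eq', Finset.mem_univ, if_true, Finset.sum_const,
            Finset.card_univ, nsmul_eq_mul]
          rw [← hkdef]
          field_simp
          ring
  have htot : ∑ y : Fin n → Y, ∏ i, w i (y i) ≤ 1 := by
    rw [← Fintype.prod_sum]
    exact Finset.prod_le_one (fun i _ => Finset.sum_nonneg fun y _ => hw0 i y) fun i _ => hw1 i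
  set E := -q * Real.log q - (1 - q) * Real.log (1 - q) + q * Real.log k with hE
  have hball : ∀ y : Fin n → Y, hammingDist y b ≤ l → Real.exp (-(n * E)) ≤ ∏ i, w i (y i) := by
    intro y hy
    have hprod : ∏ i, w i (y i) =
        Real.exp (∑ i, if y i ≠ b i then Real.log q - Real.log k else Real.log (1 - q)) := by
      rw [Real.exp_sum]
      refine Finset.prod_congr rfl fun i _ => ?_
      by_cases h : y i = b i
      · simp [w, h, Real.exp_log hq1]
      · simp [w, h, Real.exp_sub, Real.exp_log hq, Real.exp_log hk0]
    have hsum : (∑ i, if y i ≠ b i then Real.log q - Real.log k else Real.log (1 - q)) =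
        n * Real.log (1 - q) -
          hammingDist y b * (Real.log (1 - q) - (Real.log q - Real.log k)) := by
      have : ∀ i, (if y i ≠ b i then Real.log q - Real.log k else Real.log (1 - q)) =
          Real.log (1 - q) - (if y i ≠ b i then (1 : ℝ) else 0) *
            (Real.log (1 - q) - (Real.log q - Real.log k)) := by
        intro i
        split_ifs <;> ring
      rw [Finset.sum_congr rfl fun i _ => this i, Finset.sum_sub_distrib, ← Finset.sum_mul,
        Finset.sum_boole]
      simp [hammingDist]
    rw [hprod, hsum, Real.exp_le_exp]
    have hd : (hammingDist y b : ℝ) ≤ n * q := le_trans (by exact_mod_cast hy) hl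
    have hlog : Real.log q ≤ Real.log (1 - q) := Real.log_le_log hq (by linarith)
    have hlogk : 0 ≤ Real.log k := Real.log_nonneg hk
    have := mul_le_mul_of_nonneg_right hd
      (show 0 ≤ Real.log (1 - q) - (Real.log q - Real.log k) by linarith)
    rw [hE]
    linarith
  have hmul : ((Finset.univ.filter fun y => hammingDist y b ≤ l).card : ℝ) *
      Real.exp (-(n * E)) ≤ 1 := by
    rw [← nsmul_eq_mul]
    refine le_trans (Finset.card_nsmul_le_sum _ (fun y => ∏ i, w i (y i)) _ fun y hy => ?_) ?_
    · exact hball y (Finset.mem_filter.mp hy).2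
    · exact (Finset.sum_le_univ_sum_of_nonneg fun y =>
        Finset.prod_nonneg fun i _ => hw0 i _).trans htot
  rwa [Real.exp_neg, ← div_eq_mul_inv, div_le_one (Real.exp_pos _)] at hmul

lemma card_hammingNbhd_le {Y : Type*} [Fintype Y] {n : ℕ} (B : Finset (Fin n → Y)) (l : ℕ) {V : ℝ}
    (hV : ∀ b : Fin n → Y, ((Finset.univ.filter fun y => hammingDist y b ≤ l).card : ℝ) ≤ V) :
    ((hammingNbhd B l).card : ℝ) ≤ B.card * V := by
  have hsub : hammingNbhd B l ⊆
      B.biUnion fun b => Finset.univ.filter fun y => hammingDist y b ≤ l := by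
    intro y hy
    simpa [hammingNbhd] using hy
  calc ((hammingNbhd B l).card : ℝ)
      ≤ ((∑ b ∈ B, (Finset.univ.filter fun y => hammingDist y b ≤ l).card : ℕ) : ℝ) := by
        exact_mod_cast (Finset.card_le_card hsub).trans Finset.card_biUnion_le
    _ ≤ B.card * V := by
        push_cast
        rw [← nsmul_eq_mul]
        exact Finset.sum_le_card_nsmul _ _ _ fun b _ => hV b

lemma gimg_le_card {𝒳 𝒴 : Type*} [Fintype 𝒴] {W : Channel 𝒳 𝒴} {n : ℕ}
    {A : Set (Fin n → 𝒳)} {η : ℝ} {B : Finset (Fin n → 𝒴)} (hB : IsImage W n A η B) :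
    gimg W n A η ≤ B.card :=
  Nat.sInf_le ⟨B, hB, rfl⟩

lemma exists_isImage_card_eq_gimg {𝒳 𝒴 : Type*} [Fintype 𝒴] (W : Channel 𝒳 𝒴) (n : ℕ)
    (A : Set (Fin n → 𝒳)) {η : ℝ} (hη : η ≤ 1) :
    ∃ B : Finset (Fin n → 𝒴), IsImage W n A η B ∧ B.card = gimg W n A η := by
  refine Nat.sInf_mem (s := {k | ∃ B : Finset (Fin n → 𝒴), IsImage W n A η B ∧ B.card = k})
    ⟨_, Finset.univ, fun x _ => hη.trans ?_, rfl⟩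
  exact (sum_prod_eq_one (fun i => W.w (x i)) fun i => W.sum_one _).ge

/-- Lemma `tau` bound on image size ratios. -/
theorem image_size_ratio_bound
    (𝒳 𝒴 : Type) [Fintype 𝒳] [Fintype 𝒴] [Nonempty 𝒳] [Nonempty 𝒴]
    (n : ℕ) (hn : 0 < n) (W : Channel 𝒳 𝒴) (α β : ℝ)
    (hα0 : 0 < α) (hα1 : α < 1) (hβ0 : 0 < β) (hβ1 : β ≤ 1 - α)
    (q : ℝ)
    (hq : q = (Real.sqrt (-Real.log β) + Real.sqrt (-Real.log α)) / Real.sqrt (2 * n))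
    (hq2 : q ≤ 1 / 2)
    (A : Set (Fin n → 𝒳)) (hA : A.Nonempty) :
    0 ≤ (1 / n) * Real.logb 2 ((gimg W n A (1 - β) : ℝ) / (gimg W n A α : ℝ)) ∧
    (1 / n) * Real.logb 2 ((gimg W n A (1 - β) : ℝ) / (gimg W n A α : ℝ)) ≤
      (-q * Real.logb 2 q - (1 - q) * Real.logb 2 (1 - q)) +
        q * Real.logb 2 (Fintype.card 𝒴) := by
  have hn' : (0 : ℝ) < n := by exact_mod_cast hn
  obtain ⟨B, hB, hBcard⟩ := exists_isImage_card_eq_gimg W n A hα1.le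
  obtain ⟨C, hC, hCcard⟩ := exists_isImage_card_eq_gimg W n A (show 1 - β ≤ 1 by linarith)
  obtain ⟨x₀, hx₀⟩ := hA
  have hBpos : 0 < B.card := by
    rw [Finset.card_pos]
    by_contra h
    have := hB x₀ hx₀
    rw [Finset.not_nonempty_iff_eq_empty.mp h, imgMass, Finset.sum_empty] at this
    linarith
  have hle : gimg W n A α ≤ gimg W n A (1 - β) := by
    rw [← hCcard]
    exact gimg_le_card fun x hx => (by linarith : α ≤ 1 - β).trans (hC x hx)
  have hgpos : (0 : ℝ) < gimg W n A α := by
    rw [← hBcard]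
    exact_mod_cast hBpos
  have hratio : (1 : ℝ) ≤ (gimg W n A (1 - β) : ℝ) / gimg W n A α := by
    rw [one_le_div hgpos]
    exact_mod_cast hle
  refine ⟨mul_nonneg (by positivity) (Real.logb_nonneg one_lt_two hratio), ?_⟩
  have hnq : n * q = Real.sqrt (n / 2) * Real.sqrt (-Real.log β) +
      Real.sqrt (n / 2) * Real.sqrt (-Real.log α) := by
    have h1 : (n : ℝ) / Real.sqrt (2 * n) = Real.sqrt (n / 2) := by
      rw [div_eq_iff (by positivity), ← Real.sqrt_mul (by positivity)]
      rw [show (n : ℝ) / 2 * (2 * n) = n ^ 2 by ring, Real.sqrt_sq hn'.le]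
    rw [hq, ← h1]
    ring
  have hq0 : 0 < q := by
    have : 0 < Real.sqrt (-Real.log α) := Real.sqrt_pos.mpr (by linarith [Real.log_neg hα0 hα1])
    rw [hq]
    positivity
  set l := ⌊(n : ℝ) * q⌋₊
  have hl : (l : ℝ) ≤ n * q := Nat.floor_le (by positivity)
  have hl' : (n : ℝ) * q < l + 1 := Nat.lt_floor_add_one _
  have himg : IsImage W n A (1 - β) (hammingNbhd B l) := fun x hx =>
    blowing_up hn (fun i => W.w (x i)) (fun i => W.nonneg _) (fun i => W.sum_one _) B hα0 hβ0
      (hB x hx) l (hnq ▸ hl')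
  set E := -q * Real.log q - (1 - q) * Real.log (1 - q) + q * Real.log (Fintype.card 𝒴) with hE
  have hcard : (gimg W n A (1 - β) : ℝ) ≤ gimg W n A α * Real.exp (n * E) := by
    rw [← hBcard]
    refine le_trans (by exact_mod_cast gimg_le_card himg) (card_hammingNbhd_le B l fun b => ?_)
    exact card_hammingBall_le hq0 hq2 hl b
  have hlog : Real.log ((gimg W n A (1 - β) : ℝ) / gimg W n A α) ≤ n * E := by
    rw [Real.log_le_iff_le_exp (by linarith), div_le_iff₀ hgpos, mul_comm]
    exact hcard
  have hlog2 : 0 < Real.log 2 := Real.log_pos one_lt_two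
  calc 1 / (n : ℝ) * Real.logb 2 ((gimg W n A (1 - β) : ℝ) / gimg W n A α)
      ≤ 1 / n * (n * E / Real.log 2) := by
        rw [Real.logb]
        gcongr
    _ = _ := by
        rw [hE]
        simp only [Real.logb]
        field_simp

end Paper
end
end

section
/- Let Y be a random variable on a finite set 𝒴 with P(Y=y) > 0 for every y ∈ 𝒴, let λ > 0 and t ∈ ℕ₊, and for s ∈ [0:t] define the slice S(s) = { y ∈ 𝒴 : ⌊min(h_Y(y)/λ, t)⌋ = s } and ϱ(s) = −log₂ P(Y ∈ S(s)). Then for every s ∈ [0:t−1] with S(s) ≠ ∅: s·λ − ϱ(s) ≤ log₂|S(s)| < (s+1)·λ − ϱ(s). Moreover, if t > λ^{−1}·log₂|𝒴| and S(t) ≠ ∅, then t·λ − ϱ(t) ≤ log₂|S(t)| < (t+1)·λ. -/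
open scoped Classical BigOperators

noncomputable section

namespace Paper

variable {Ω : Type*}

lemma pr_preimage_finset {Ω 𝒴 : Type*} (μ : PMF Ω) (Y : Ω → 𝒴) (A : Finset 𝒴) :
    pr μ {ω | Y ω ∈ A} = ∑ y ∈ A, pr μ {ω | Y ω = y} := by
  have h : ∀ B : Set 𝒴, pr μ {ω | Y ω ∈ B} = ((μ.map Y).toOuterMeasure B).toReal := by
    intro B
    rw [PMF.toOuterMeasure_map_apply]
    rfl
  have h1 : ∀ y, pr μ {ω | Y ω = y} = (μ.map Y y).toReal := by
    intro y
    rw [← PMF.toOuterMeasure_apply_singleton, ← h]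
    rfl
  have h2 := h (A : Set 𝒴)
  rw [PMF.toOuterMeasure_apply_finset, ENNReal.toReal_sum fun y _ => PMF.apply_ne_top _ y] at h2
  simpa only [h1, Finset.mem_coe] using h2

lemma pr_le_rpow_of_le_hs {Ω 𝒴 : Type*} {μ : PMF Ω} {Y : Ω → 𝒴} {y : 𝒴} {a : ℝ}
    (hpos : 0 < pr μ {ω | Y ω = y}) (h : a ≤ hs μ Y y) :
    pr μ {ω | Y ω = y} ≤ (2 : ℝ) ^ (-a) := by
  rw [← Real.logb_le_iff_le_rpow one_lt_two hpos]
  unfold hs at h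
  linarith

lemma rpow_lt_pr_of_hs_lt {Ω 𝒴 : Type*} {μ : PMF Ω} {Y : Ω → 𝒴} {y : 𝒴} {a : ℝ}
    (hpos : 0 < pr μ {ω | Y ω = y}) (h : hs μ Y y < a) :
    (2 : ℝ) ^ (-a) < pr μ {ω | Y ω = y} := by
  rw [← Real.lt_logb_iff_rpow_lt one_lt_two hpos]
  unfold hs at h
  linarith

lemma logb_card_mul_rpow {n : ℕ} (hn : 0 < n) (a : ℝ) :
    Real.logb 2 (n * (2 : ℝ) ^ (-a)) = Real.logb 2 n - a := by
  rw [Real.logb_mul (by positivity) (by positivity), Real.logb_rpow two_pos (by norm_num)]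
  ring

/-- A set on which the entropy spectrum is at least `a` has at least `2 ^ a * P(Y ∈ A)` elements. -/
lemma add_logb_pr_le_logb_card {Ω 𝒴 : Type*} {μ : PMF Ω} {Y : Ω → 𝒴} {A : Finset 𝒴} {a : ℝ}
    (hA : A.Nonempty) (hpos : ∀ y ∈ A, 0 < pr μ {ω | Y ω = y}) (h : ∀ y ∈ A, a ≤ hs μ Y y) :
    a + Real.logb 2 (pr μ {ω | Y ω ∈ A}) ≤ Real.logb 2 A.card := by
  have hle : pr μ {ω | Y ω ∈ A} ≤ A.card * (2 : ℝ) ^ (-a) := by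
    rw [pr_preimage_finset, ← nsmul_eq_mul]
    exact Finset.sum_le_card_nsmul _ _ _ fun y hy => pr_le_rpow_of_le_hs (hpos y hy) (h y hy)
  have hP : 0 < pr μ {ω | Y ω ∈ A} := by
    rw [pr_preimage_finset]
    exact Finset.sum_pos hpos hA
  have := Real.logb_le_logb_of_le one_lt_two hP hle
  rw [logb_card_mul_rpow hA.card_pos] at this
  linarith

/-- A set on which the entropy spectrum is below `a` has fewer than `2 ^ a * P(Y ∈ A)` elements. -/
lemma logb_card_lt_add_logb_pr {Ω 𝒴 : Type*} {μ : PMF Ω} {Y : Ω → 𝒴} {A : Finset 𝒴} {a : ℝ}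
    (hA : A.Nonempty) (hpos : ∀ y ∈ A, 0 < pr μ {ω | Y ω = y}) (h : ∀ y ∈ A, hs μ Y y < a) :
    Real.logb 2 A.card < a + Real.logb 2 (pr μ {ω | Y ω ∈ A}) := by
  have hlt : A.card * (2 : ℝ) ^ (-a) < pr μ {ω | Y ω ∈ A} := by
    rw [pr_preimage_finset, ← nsmul_eq_mul, ← Finset.sum_const]
    exact Finset.sum_lt_sum_of_nonempty hA fun y hy => rpow_lt_pr_of_hs_lt (hpos y hy) (h y hy)
  have hn := hA.card_pos
  have := Real.logb_lt_logb one_lt_two (by positivity) hlt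
  rw [logb_card_mul_rpow hn] at this
  linarith

/-- slice size bounds, Lemma `bk_prob` / Corollary `bk_size`. -/
theorem slice_size_bounds
    {Ω : Type} (𝒴 : Type) [Fintype 𝒴] (μ : PMF Ω) (Y : Ω → 𝒴)
    (hpos : ∀ y : 𝒴, 0 < pr μ {ω | Y ω = y})
    (lam : ℝ) (hlam : 0 < lam) (t : ℕ) (ht : 0 < t)
    (S : ℕ → Finset 𝒴)
    (hS : ∀ s : ℕ, S s =
      Finset.univ.filter (fun y => ⌊min (hs μ Y y / lam) (t : ℝ)⌋ = (s : ℤ)))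
    (ϱ : ℕ → ℝ) (hϱ : ∀ s : ℕ, ϱ s = - Real.logb 2 (pr μ {ω | Y ω ∈ S s})) :
    (∀ s : ℕ, s < t → (S s).Nonempty →
      (s : ℝ) * lam - ϱ s ≤ Real.logb 2 ((S s).card) ∧
      Real.logb 2 ((S s).card) < ((s : ℝ) + 1) * lam - ϱ s) ∧
    ((t : ℝ) > Real.logb 2 (Fintype.card 𝒴) / lam → (S t).Nonempty →
      (t : ℝ) * lam - ϱ t ≤ Real.logb 2 ((S t).card) ∧
      Real.logb 2 ((S t).card) < ((t : ℝ) + 1) * lam) := by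
  have hlow : ∀ s : ℕ, ∀ y ∈ S s, (s : ℝ) * lam ≤ hs μ Y y := by
    intro s y hy
    rw [hS, Finset.mem_filter, Int.floor_eq_iff] at hy
    have h := hy.2.1.trans (min_le_left _ _)
    rwa [Int.cast_natCast, le_div_iff₀ hlam] at h
  have hlower : ∀ s : ℕ, (S s).Nonempty → (s : ℝ) * lam - ϱ s ≤ Real.logb 2 ((S s).card) := by
    intro s hs
    rw [hϱ, sub_neg_eq_add]
    exact add_logb_pr_le_logb_card hs (fun y _ => hpos y) (hlow s)
  refine ⟨fun s hst hs => ⟨hlower s hs, ?_⟩, fun htc ht' => ⟨hlower t ht', ?_⟩⟩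
  · rw [hϱ, sub_neg_eq_add]
    refine logb_card_lt_add_logb_pr hs (fun y _ => hpos y) fun y hy => ?_
    rw [hS, Finset.mem_filter, Int.floor_eq_iff, Int.cast_natCast, min_lt_iff] at hy
    have hst' : (s : ℝ) + 1 ≤ t := by exact_mod_cast hst
    rw [← div_lt_iff₀ hlam]
    exact hy.2.2.resolve_right hst'.not_gt
  · have hcard : Real.logb 2 (S t).card ≤ Real.logb 2 (Fintype.card 𝒴) :=
      Real.logb_le_logb_of_le one_lt_two (by exact_mod_cast ht'.card_pos)
        (by exact_mod_cast (S t).card_le_univ)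
    rw [gt_iff_lt, div_lt_iff₀ hlam] at htc
    linarith

end Paper
end
end

section
/- Let 𝒳 and 𝒴 be finite sets with |𝒳| ≥ 2 and |𝒴| ≥ 2, let n ∈ ℕ₊, W ∈ 𝒫(𝒴|𝒳), and α, ε ∈ (0,1). Let P be a probability mass function on 𝒳^n with support A, and let B ⊆ 𝒴^n be an α-quasi-image of P by W of minimum cardinality (so |B| = ḡ^n_W(P,α)). Put A' = { 𝐱 ∈ A : W^n(B|𝐱) ≥ ε }. Then: (i) P(A') ≥ (α−ε)/(1−ε); and (ii) B is an ε-image of A' by W, so that g^n_W(A', ε) ≤ ḡ^n_W(P, α). -/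
open scoped Classical BigOperators

noncomputable section

namespace Paper

variable {Ω : Type*}

theorem Channel.pn_nonneg {𝒳 𝒴 : Type*} [Fintype 𝒴] (W : Channel 𝒳 𝒴) (n : ℕ)
    (x : Fin n → 𝒳) (y : Fin n → 𝒴) : 0 ≤ W.pn n x y :=
  Finset.prod_nonneg fun _ _ => W.nonneg _ _

theorem Channel.sum_pn {𝒳 𝒴 : Type*} [Fintype 𝒴] (W : Channel 𝒳 𝒴) (n : ℕ)
    (x : Fin n → 𝒳) : ∑ y, W.pn n x y = 1 := by
  simp only [Channel.pn]
  rw [← Fintype.prod_sum]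
  simp [W.sum_one]

theorem imgMass_le_one {𝒳 𝒴 : Type*} [Fintype 𝒴] (W : Channel 𝒳 𝒴) (n : ℕ)
    (x : Fin n → 𝒳) (B : Finset (Fin n → 𝒴)) : imgMass W n x B ≤ 1 := by
  rw [← W.sum_pn n x]
  exact Finset.sum_le_sum_of_subset_of_nonneg (Finset.subset_univ B)
    fun y _ _ => W.pn_nonneg n x y

/-- Lemma `ApsubA`. -/
theorem quasi_image_to_image
    (𝒳 𝒴 : Type) [Fintype 𝒳] [Fintype 𝒴]
    (hX : 2 ≤ Fintype.card 𝒳) (hY : 2 ≤ Fintype.card 𝒴)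
    (n : ℕ) (hn : 0 < n) (W : Channel 𝒳 𝒴) (α ε : ℝ)
    (hα0 : 0 < α) (hα1 : α < 1) (hε0 : 0 < ε) (hε1 : ε < 1)
    (P : (Fin n → 𝒳) → ℝ) (hP0 : ∀ x, 0 ≤ P x) (hP1 : ∑ x, P x = 1)
    (B : Finset (Fin n → 𝒴)) (hB : IsQImage W n P α B)
    (hBmin : B.card = gqimg W n P α) :
    (α - ε) / (1 - ε) ≤
        (∑ x ∈ Finset.univ.filter (fun x => 0 < P x ∧ ε ≤ imgMass W n x B), P x) ∧
    IsImage W n {x | 0 < P x ∧ ε ≤ imgMass W n x B} ε B ∧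
    gimg W n {x | 0 < P x ∧ ε ≤ imgMass W n x B} ε ≤ gqimg W n P α := by
  have hImage : IsImage W n {x | 0 < P x ∧ ε ≤ imgMass W n x B} ε B := fun _ hx => hx.2
  refine ⟨?_, hImage, hBmin ▸ Nat.sInf_le ⟨B, hImage, rfl⟩⟩
  have hpoint : ∀ x, imgMass W n x B * P x ≤
      (1 - ε) * (if 0 < P x ∧ ε ≤ imgMass W n x B then P x else 0) + ε * P x := by
    intro x
    have hle := imgMass_le_one W n x B
    split_ifs with h
    · nlinarith [hP0 x]
    · rcases (hP0 x).eq_or_lt with h0 | h0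
      · simp [← h0]
      · have hlt : imgMass W n x B < ε := not_le.mp fun h' => h ⟨h0, h'⟩
        nlinarith
  rw [div_le_iff₀ (by linarith), Finset.sum_filter]
  have hsum := hB.trans (Finset.sum_le_sum fun x _ => hpoint x)
  rw [Finset.sum_add_distrib, ← Finset.mul_sum, ← Finset.mul_sum, hP1] at hsum
  linarith

end Paper
end
end

section
/- Let 𝒳 and 𝒴 be finite sets with |𝒳| ≥ 2 and |𝒴| ≥ 2, let n ∈ ℕ₊, W ∈ 𝒫(𝒴|𝒳), let P be a probability mass function on 𝒳^n, and let 𝐘 be an output of 𝐗 ∼ P through W^n. Let λ > 0 and t ∈ ℕ₊ satisfy λ·t > n·log₂|𝒴|, and for s ∈ [0:t] define S(s) = { 𝐲 ∈ 𝒴^n : P(𝐘=𝐲) > 0 and ⌊min(h_𝐘(𝐲)/λ, t)⌋ = s } and η_s = P(𝐘 ∈ ∪_{i=0}^s S(i)). Then for every s ∈ [0:t] with η_s > 0: (i) ∪_{i=0}^s S(i) is the unique set of minimum cardinality among all sets B ⊆ 𝒴^n with P(𝐘 ∈ B) ≥ η_s (i.e., it is the unique minimum η_s-quasi-image of P by W);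 and (ii) 2^{s·λ}·P(𝐘 ∈ S(s)) ≤ ḡ^n_W(P, η_s) < (t+1)·2^{(s+1)·λ}. -/
open scoped Classical BigOperators

noncomputable section

namespace Paper

variable {Ω : Type*}

theorem pr_nonneg (μ : PMF Ω) (E : Set Ω) : 0 ≤ pr μ E := ENNReal.toReal_nonneg

theorem pr_mono (μ : PMF Ω) {E F : Set Ω} (h : E ⊆ F) : pr μ E ≤ pr μ F := by
  have h_top : μ.toOuterMeasure F ≠ ⊤ :=
    ne_top_of_le_ne_top ENNReal.one_ne_top
      ((μ.toOuterMeasure_apply F).trans_le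
        ((ENNReal.tsum_le_tsum fun _ => Set.indicator_le_self _ _ _).trans_eq μ.tsum_coe))
  exact ENNReal.toReal_mono h_top (μ.toOuterMeasure.mono h)

theorem pr_univ (μ : PMF Ω) : pr μ Set.univ = 1 := by
  have : μ.toOuterMeasure Set.univ = 1 :=
    (μ.toOuterMeasure_apply_eq_one_iff Set.univ).2 (Set.subset_univ _)
  rw [pr, this, ENNReal.toReal_one]

theorem pr_le_one (μ : PMF Ω) (E : Set Ω) : pr μ E ≤ 1 :=
  (pr_mono μ (Set.subset_univ E)).trans_eq (pr_univ μ)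

/-- The probability that `Z` lies in a finite set is the sum of the point probabilities. -/
theorem pr_mem_finset {α : Type*} (μ : PMF Ω) (Z : Ω → α) (B : Finset α) :
    pr μ {ω | Z ω ∈ B} = ∑ z ∈ B, pr μ {ω | Z ω = z} := by
  have h_point (z : α) : pr μ {ω | Z ω = z} = ((μ.map Z) z).toReal := by
    rw [← PMF.toOuterMeasure_apply_singleton (μ.map Z) z, PMF.toOuterMeasure_map_apply]
    rfl
  have h_set : pr μ {ω | Z ω ∈ B} = ((μ.map Z).toOuterMeasure (B : Set α)).toReal := by
    rw [PMF.toOuterMeasure_map_apply]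
    rfl
  rw [h_set, PMF.toOuterMeasure_apply_finset,
    ENNReal.toReal_sum fun z _ => PMF.apply_ne_top _ z]
  exact Finset.sum_congr rfl fun z _ => (h_point z).symm

/-- The output law: averaging `W^n(B|𝐱)` over the input law gives the mass of `B`. -/
theorem IsOutput.sum_imgMass {𝒳 𝒴 : Type*} [Fintype 𝒳] [Fintype 𝒴] {n : ℕ} {μ : PMF Ω}
    {X : Ω → Fin n → 𝒳} {Y : Ω → Fin n → 𝒴} {W : Channel 𝒳 𝒴} (hout : IsOutput μ X Y W)
    (B : Finset (Fin n → 𝒴)) :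
    ∑ x, imgMass W n x B * pr μ {ω | X ω = x} = pr μ {ω | Y ω ∈ B} := by
  have h_joint (x : Fin n → 𝒳) (y : Fin n → 𝒴) :
      W.pn n x y * pr μ {ω | X ω = x} = pr μ {ω | (X ω, Y ω) = (x, y)} := by
    have h_inter : {ω | (X ω, Y ω) = (x, y)} = {ω | Y ω = y} ∩ {ω | X ω = x} := by
      ext ω
      simp [and_comm]
    rw [h_inter]
    rcases (pr_nonneg μ {ω | X ω = x}).eq_or_lt with h | h
    · rw [← h, mul_zero]
      exact le_antisymm (pr_nonneg _ _) (h ▸ pr_mono μ Set.inter_subset_right)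
    · rw [← hout x y h, cpr, div_mul_cancel₀ _ h.ne']
  calc ∑ x, imgMass W n x B * pr μ {ω | X ω = x}
      = ∑ x, ∑ y ∈ B, pr μ {ω | (X ω, Y ω) = (x, y)} := by
        simp_rw [imgMass, Finset.sum_mul, h_joint]
    _ = pr μ {ω | (X ω, Y ω) ∈ Finset.univ ×ˢ B} := by
        rw [pr_mem_finset μ (fun ω => (X ω, Y ω)), Finset.sum_product]
    _ = pr μ {ω | Y ω ∈ B} := by simp

/-- A strict superlevel set of a function is the only set of at most its cardinality carrying
at least its mass. -/
theorem eq_superlevel_of_card_le {α : Type*} {q : α → ℝ} {c : ℝ} (hc : 0 ≤ c)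
    {U B : Finset α} (hU : ∀ y, y ∈ U ↔ c < q y) (h_sum : ∑ y ∈ U, q y ≤ ∑ y ∈ B, q y)
    (h_card : B.card ≤ U.card) : B = U := by
  refine (Finset.eq_of_subset_of_card_le (fun y hy => ?_) h_card).symm
  by_contra hyB
  have h_ne : (U \ B).Nonempty := ⟨y, Finset.mem_sdiff.2 ⟨hy, hyB⟩⟩
  have h_mass : ∑ y ∈ U \ B, q y ≤ ∑ y ∈ B \ U, q y := by
    have h₁ := Finset.sum_inter_add_sum_sdiff U B q
    have h₂ := Finset.sum_inter_add_sum_sdiff B U q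
    rw [Finset.inter_comm] at h₂
    linarith
  have h_diff : ((B \ U).card : ℝ) ≤ (U \ B).card := by
    have h₁ := Finset.card_sdiff_add_card_inter U B
    have h₂ := Finset.card_sdiff_add_card_inter B U
    rw [Finset.inter_comm] at h₂
    exact_mod_cast (by omega : (B \ U).card ≤ (U \ B).card)
  have h_lower : (U \ B).card * c < ∑ y ∈ U \ B, q y := by
    rw [← nsmul_eq_mul, ← Finset.sum_const]
    exact Finset.sum_lt_sum_of_nonempty h_ne fun z hz => (hU z).1 (Finset.mem_sdiff.1 hz).1
  have h_upper : ∑ y ∈ B \ U, q y ≤ (B \ U).card * c := by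
    rw [← nsmul_eq_mul]
    exact Finset.sum_le_card_nsmul _ _ _ fun z hz =>
      not_lt.1 fun h => (Finset.mem_sdiff.1 hz).2 ((hU z).2 h)
  nlinarith

theorem hs_nonneg {α : Type*} (μ : PMF Ω) (X : Ω → α) (x : α) : 0 ≤ hs μ X x :=
  neg_nonneg.2 (Real.logb_nonpos one_lt_two (pr_nonneg _ _) (pr_le_one _ _))

theorem rpow_neg_hs {α : Type*} {μ : PMF Ω} {X : Ω → α} {x : α}
    (h : 0 < pr μ {ω | X ω = x}) : (2 : ℝ) ^ (-hs μ X x) = pr μ {ω | X ω = x} := by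
  rw [hs, neg_neg, Real.rpow_logb two_pos (by norm_num) h]

/-- Lemma `barg_bound`. -/
theorem slices_are_minimal_quasi_images
    (𝒳 𝒴 : Type) [Fintype 𝒳] [Fintype 𝒴]
    (hX : 2 ≤ Fintype.card 𝒳) (hY : 2 ≤ Fintype.card 𝒴)
    (n : ℕ) (hn : 0 < n) (W : Channel 𝒳 𝒴)
    (P : (Fin n → 𝒳) → ℝ) (hP0 : ∀ x, 0 ≤ P x) (hP1 : ∑ x, P x = 1)
    (Ω : Type) (μ : PMF Ω) (X : Ω → Fin n → 𝒳) (Y : Ω → Fin n → 𝒴)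
    (hXlaw : ∀ x, pr μ {ω | X ω = x} = P x) (hout : IsOutput μ X Y W)
    (lam : ℝ) (hlam : 0 < lam) (t : ℕ) (ht : 0 < t)
    (hlt : (n : ℝ) * Real.logb 2 (Fintype.card 𝒴) < lam * t)
    (S : ℕ → Finset (Fin n → 𝒴))
    (hS : ∀ s : ℕ, S s = Finset.univ.filter (fun y =>
      0 < pr μ {ω | Y ω = y} ∧
        ⌊min (hs μ Y y / lam) (t : ℝ)⌋ = (s : ℤ)))
    (Us : ℕ → Finset (Fin n → 𝒴))
    (hUs : ∀ s : ℕ, Us s = (Finset.range (s + 1)).biUnion S)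
    (η : ℕ → ℝ) (hη : ∀ s : ℕ, η s = pr μ {ω | Y ω ∈ Us s}) :
    ∀ s : ℕ, s ≤ t → 0 < η s →
      ((∀ B : Finset (Fin n → 𝒴), η s ≤ pr μ {ω | Y ω ∈ B} →
          (Us s).card ≤ B.card ∧ (B.card = (Us s).card → B = Us s)) ∧
        IsQImage W n P (η s) (Us s) ∧
        (2 : ℝ) ^ ((s : ℝ) * lam) * pr μ {ω | Y ω ∈ S s} ≤ (gqimg W n P (η s) : ℝ) ∧
        (gqimg W n P (η s) : ℝ) < ((t : ℝ) + 1) * 2 ^ (((s : ℝ) + 1) * lam)) := by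
  intro s hst hη_pos
  set q : (Fin n → 𝒴) → ℝ := fun y => pr μ {ω | Y ω = y}
  have hq_hs (y : Fin n → 𝒴) (hy : 0 < q y) : (2 : ℝ) ^ (-hs μ Y y) = q y := rpow_neg_hs hy
  have hpr (B : Finset (Fin n → 𝒴)) : pr μ {ω | Y ω ∈ B} = ∑ y ∈ B, q y := pr_mem_finset μ Y B
  have hqimg (B : Finset (Fin n → 𝒴)) :
      IsQImage W n P (η s) B ↔ η s ≤ pr μ {ω | Y ω ∈ B} := by
    rw [IsQImage, ← hout.sum_imgMass]
    simp_rw [hXlaw]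
  have hmem (y : Fin n → 𝒴) :
      y ∈ Us s ↔ 0 < q y ∧ ⌊min (hs μ Y y / lam) (t : ℝ)⌋ ≤ (s : ℤ) := by
    have h_floor : 0 ≤ ⌊min (hs μ Y y / lam) (t : ℝ)⌋ :=
      Int.floor_nonneg.2 (le_min (div_nonneg (hs_nonneg μ Y y) hlam.le) t.cast_nonneg)
    simp only [hUs, hS, Finset.mem_biUnion, Finset.mem_range, Finset.mem_filter,
      Finset.mem_univ, true_and]
    constructor
    · rintro ⟨i, hi, hy, h⟩
      exact ⟨hy, by omega⟩
    · rintro ⟨hy, h⟩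
      exact ⟨⌊min (hs μ Y y / lam) (t : ℝ)⌋.toNat, by omega, hy, by omega⟩
  have hmem_lt (h : s < t) (y : Fin n → 𝒴) :
      y ∈ Us s ↔ (2 : ℝ) ^ (-(((s : ℝ) + 1) * lam)) < q y := by
    have hts : (s : ℝ) + 1 ≤ t := by exact_mod_cast h
    have h_floor : ⌊min (hs μ Y y / lam) (t : ℝ)⌋ ≤ (s : ℤ) ↔
        hs μ Y y < ((s : ℝ) + 1) * lam := by
      rw [← Int.lt_add_one_iff, Int.floor_lt, ← div_lt_iff₀ hlam]
      push_cast
      rw [min_lt_iff, or_iff_left hts.not_gt]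
    rw [hmem, h_floor]
    constructor
    · rintro ⟨hy, h⟩
      rw [← hq_hs y hy]
      exact Real.rpow_lt_rpow_of_exponent_lt one_lt_two (neg_lt_neg h)
    · intro h
      have hy : 0 < q y := (Real.rpow_pos_of_pos two_pos _).trans h
      rw [← hq_hs y hy, Real.rpow_lt_rpow_left_iff one_lt_two] at h
      exact ⟨hy, neg_lt_neg_iff.1 h⟩
  have hlevel : ∃ c : ℝ, 0 ≤ c ∧ ∀ y, y ∈ Us s ↔ c < q y := by
    rcases hst.lt_or_eq with h | rfl
    · exact ⟨_, (Real.rpow_pos_of_pos two_pos _).le, hmem_lt h⟩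
    · refine ⟨0, le_rfl, fun y => (hmem y).trans (and_iff_left ?_)⟩
      exact_mod_cast (Int.floor_le_floor (min_le_right _ _)).trans_eq (Int.floor_natCast s)
  obtain ⟨c, hc, hUc⟩ := hlevel
  have hunique (B : Finset (Fin n → 𝒴)) (hB : η s ≤ pr μ {ω | Y ω ∈ B})
      (h_card : B.card ≤ (Us s).card) : B = Us s := by
    rw [hη, hpr, hpr] at hB
    exact eq_superlevel_of_card_le hc hUc hB h_card
  have hmin (B : Finset (Fin n → 𝒴)) (hB : η s ≤ pr μ {ω | Y ω ∈ B}) :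
      (Us s).card ≤ B.card := by
    by_contra! h
    exact h.ne (congrArg Finset.card (hunique B hB h.le))
  have hU : IsQImage W n P (η s) (Us s) := (hqimg _).2 (hη s).le
  have hg : gqimg W n P (η s) = (Us s).card := by
    refine le_antisymm (Nat.sInf_le ⟨_, hU, rfl⟩) ?_
    refine le_csInf ⟨_, _, hU, rfl⟩ ?_
    rintro _ ⟨B, hB, rfl⟩
    exact hmin B ((hqimg B).1 hB)
  refine ⟨fun B hB => ⟨hmin B hB, fun h => hunique B hB h.le⟩, hU, ?_, ?_⟩
  · have h_point : ∀ y ∈ S s, q y ≤ (2 : ℝ) ^ (-((s : ℝ) * lam)) := by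
      intro y hy
      rw [hS, Finset.mem_filter] at hy
      obtain ⟨-, hy, h⟩ := hy
      have hle := (Int.le_floor.1 h.ge).trans (min_le_left _ _)
      rw [Int.cast_natCast, le_div_iff₀ hlam] at hle
      rw [← hq_hs y hy]
      exact Real.rpow_le_rpow_of_exponent_le one_le_two (neg_le_neg hle)
    have h_sub : S s ⊆ Us s := by
      rw [hUs]
      exact Finset.subset_biUnion_of_mem S (Finset.self_mem_range_succ s)
    have h_sum := Finset.sum_le_card_nsmul _ _ _ h_point
    rw [nsmul_eq_mul, Real.rpow_neg two_pos.le, ← div_eq_mul_inv,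
      le_div_iff₀' (Real.rpow_pos_of_pos two_pos _)] at h_sum
    rw [hg, hpr]
    exact h_sum.trans (by exact_mod_cast Finset.card_le_card h_sub)
  · have h_pow : 0 < (2 : ℝ) ^ (((s : ℝ) + 1) * lam) := Real.rpow_pos_of_pos two_pos _
    have ht' : (0 : ℝ) < t := by exact_mod_cast ht
    suffices h : ((Us s).card : ℝ) ≤ 2 ^ (((s : ℝ) + 1) * lam) by
      rw [hg]
      nlinarith
    rcases hst.lt_or_eq with h | rfl
    · have h_sum := Finset.card_nsmul_le_sum _ _ _ fun y hy => ((hmem_lt h y).1 hy).le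
      rw [nsmul_eq_mul, ← hpr, Real.rpow_neg two_pos.le, ← div_eq_mul_inv,
        div_le_iff₀ h_pow] at h_sum
      nlinarith [pr_le_one μ {ω | Y ω ∈ Us s}]
    · have hY' : (0 : ℝ) < Fintype.card 𝒴 := by exact_mod_cast two_pos.trans_le hY
      calc ((Us s).card : ℝ) ≤ (Fintype.card 𝒴 : ℝ) ^ n := by
            have h := Finset.card_le_univ (Us s)
            rw [Fintype.card_pi_const] at h
            exact_mod_cast h
        _ = 2 ^ ((n : ℝ) * Real.logb 2 (Fintype.card 𝒴)) := by
            rw [mul_comm, Real.rpow_mul two_pos.le, Real.rpow_logb two_pos (by norm_num) hY',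
              Real.rpow_natCast]
        _ ≤ 2 ^ (((s : ℝ) + 1) * lam) :=
            Real.rpow_le_rpow_of_exponent_le one_le_two (by linarith)

end Paper
end
end

section
/- Let V and U be jointly distributed random variables taking values in finite sets 𝒱 and 𝒰, and let α > 0. Then Pr( |h(V|U) − h(V)| > α ) < (|𝒰| + 1)·2^{−α}. -/
open scoped Classical BigOperators

noncomputable section

namespace Paper

variable {Ω : Type*}

theorem pr_preimage_eq_sum_map {β : Type*} [Fintype β] (μ : PMF Ω) (f : Ω → β) (S : Set β) :
    pr μ (f ⁻¹' S) = ∑ x, if x ∈ S then (μ.map f x).toReal else 0 := by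
  rw [pr, ← PMF.toOuterMeasure_map_apply, PMF.toOuterMeasure_apply_fintype, ENNReal.toReal_sum]
  · refine Finset.sum_congr rfl fun x _ => ?_
    by_cases hx : x ∈ S <;> simp [hx]
  · intro x _
    exact ne_top_of_le_ne_top (PMF.apply_ne_top (μ.map f) x) (Set.indicator_le_self' (by simp) x)

theorem pr_fiber {β : Type*} [Fintype β] (μ : PMF Ω) (f : Ω → β) (x : β) :
    pr μ {ω | f ω = x} = (μ.map f x).toReal := by
  have h := pr_preimage_eq_sum_map μ f {x}
  simp only [Set.mem_singleton_iff, Finset.sum_ite_eq', Finset.mem_univ, if_true] at h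
  exact h

/-- The probability of an event about `f` is the sum of the masses of the fibers of `f` in it. -/
theorem pr_setOf_comp_eq_sum {β : Type*} [Fintype β] (μ : PMF Ω) (f : Ω → β) (P : β → Prop) :
    pr μ {ω | P (f ω)} = ∑ x, if P x then pr μ {ω | f ω = x} else 0 := by
  simp only [pr_fiber]
  exact pr_preimage_eq_sum_map μ f {x | P x}

theorem sum_pr_fiber {β : Type*} [Fintype β] (μ : PMF Ω) (f : Ω → β) :
    ∑ x, pr μ {ω | f ω = x} = 1 := by
  simpa [pr_univ] using (pr_setOf_comp_eq_sum μ f fun _ => True).symm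

theorem sum_pr_fiber_inter {β γ : Type*} [Fintype β] [Fintype γ] (μ : PMF Ω)
    (X : Ω → β) (Y : Ω → γ) (y : γ) :
    ∑ x, pr μ ({ω | X ω = x} ∩ {ω | Y ω = y}) = pr μ {ω | Y ω = y} := by
  have h := pr_setOf_comp_eq_sum μ (fun ω => (X ω, Y ω)) fun z => z.2 = y
  simp only [Fintype.sum_prod_type, Finset.sum_ite_eq', Finset.mem_univ, if_true,
    Prod.mk.injEq] at h
  exact h.symm

theorem sum_cpr_le_one {β γ : Type*} [Fintype β] [Fintype γ] (μ : PMF Ω)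
    (X : Ω → β) (Y : Ω → γ) (y : γ) :
    ∑ x, cpr μ {ω | X ω = x} {ω | Y ω = y} ≤ 1 := by
  simp only [cpr]
  rw [← Finset.sum_div, sum_pr_fiber_inter]
  exact div_self_le_one _

/-- If two positive numbers have base-2 logarithms more than `α` apart, then one of them is
less than `2 ^ (-α)` times the other. -/
theorem lt_two_rpow_neg_mul_of_lt_abs_logb_sub {a b α : ℝ} (ha : 0 < a) (hb : 0 < b)
    (h : α < |Real.logb 2 a - Real.logb 2 b|) :
    a < 2 ^ (-α) * b ∨ b < 2 ^ (-α) * a := by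
  have key : ∀ {x y : ℝ}, 0 < x → 0 < y → α < Real.logb 2 y - Real.logb 2 x →
      x < 2 ^ (-α) * y := by
    intro x y hx hy hxy
    have h2 : (0 : ℝ) < 2 ^ (-α) := by positivity
    rw [← Real.logb_lt_logb_iff one_lt_two hx (by positivity), Real.logb_mul h2.ne' hy.ne',
      Real.logb_rpow two_pos (by norm_num)]
    linarith
  rcases lt_abs.1 h with h | h
  · exact Or.inr (key hb ha h)
  · exact Or.inl (key ha hb (by linarith))

theorem lt_two_rpow_neg_mul_of_spectrum_gap {β γ : Type*} (μ : PMF Ω) (X : Ω → β) (Y : Ω → γ)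
    (x : β) (y : γ) {α : ℝ} (hpos : 0 < pr μ ({ω | X ω = x} ∩ {ω | Y ω = y}))
    (h : α < |hcs μ X Y x y - hs μ X x|) :
    pr μ ({ω | X ω = x} ∩ {ω | Y ω = y}) <
      2 ^ (-α) * (pr μ {ω | X ω = x} * pr μ {ω | Y ω = y} +
        cpr μ {ω | X ω = x} {ω | Y ω = y}) := by
  have hX := hpos.trans_le (pr_mono μ Set.inter_subset_left)
  have hY := hpos.trans_le (pr_mono μ Set.inter_subset_right)
  have hc : 0 < cpr μ {ω | X ω = x} {ω | Y ω = y} := div_pos hpos hY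
  have h2 : (0 : ℝ) < 2 ^ (-α) := by positivity
  rw [hcs, hs, neg_sub_neg, abs_sub_comm] at h
  rw [mul_add]
  rcases lt_two_rpow_neg_mul_of_lt_abs_logb_sub hc hX h with h | h
  · refine lt_add_of_lt_of_pos ?_ (mul_pos h2 hc)
    rw [cpr, div_lt_iff₀ hY] at h
    linarith
  · exact ((pr_mono μ Set.inter_subset_left).trans_lt h).trans (lt_add_of_pos_left _ (by positivity))

/-- Lemma `only_lemma`. -/
theorem spectrum_change_of_conditioning
    {Ω 𝒱 𝒰 : Type} [Fintype 𝒱] [Fintype 𝒰]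
    (μ : PMF Ω) (V : Ω → 𝒱) (U : Ω → 𝒰) (α : ℝ) (hα : 0 < α) :
    pr μ {ω | |hcs μ V U (V ω) (U ω) - hs μ V (V ω)| > α} <
      ((Fintype.card 𝒰 : ℝ) + 1) * 2 ^ (-α) := by
  have h2 : (0 : ℝ) < 2 ^ (-α) := by positivity
  have hfib : ∀ z : 𝒱 × 𝒰, {ω | (V ω, U ω) = z} = {ω | V ω = z.1} ∩ {ω | U ω = z.2} := by
    intro z
    ext ω
    simp [Prod.ext_iff]
  have hlt : ∀ z : 𝒱 × 𝒰, 0 < pr μ {ω | (V ω, U ω) = z} →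
      (if |hcs μ V U z.1 z.2 - hs μ V z.1| > α then pr μ {ω | (V ω, U ω) = z} else 0) <
        2 ^ (-α) * (pr μ {ω | V ω = z.1} * pr μ {ω | U ω = z.2} +
          cpr μ {ω | V ω = z.1} {ω | U ω = z.2}) := by
    intro z hz
    rw [hfib] at hz ⊢
    split_ifs with h
    · exact lt_two_rpow_neg_mul_of_spectrum_gap μ V U z.1 z.2 hz h
    · have hV := hz.trans_le (pr_mono μ Set.inter_subset_left)
      have hU := hz.trans_le (pr_mono μ Set.inter_subset_right)
      exact mul_pos h2 (add_pos (mul_pos hV hU) (div_pos hz hU))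
  obtain ⟨z₀, -, hz₀⟩ : ∃ z ∈ Finset.univ, 0 < pr μ {ω | (V ω, U ω) = z} := by
    refine Finset.exists_lt_of_sum_lt (f := fun _ => (0 : ℝ)) ?_
    rw [sum_pr_fiber μ fun ω => (V ω, U ω)]
    simp
  calc pr μ {ω | |hcs μ V U (V ω) (U ω) - hs μ V (V ω)| > α}
      = ∑ z : 𝒱 × 𝒰, if |hcs μ V U z.1 z.2 - hs μ V z.1| > α then
          pr μ {ω | (V ω, U ω) = z} else 0 :=
        pr_setOf_comp_eq_sum μ (fun ω => (V ω, U ω))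
          fun z => |hcs μ V U z.1 z.2 - hs μ V z.1| > α
    _ < ∑ z : 𝒱 × 𝒰, 2 ^ (-α) * (pr μ {ω | V ω = z.1} * pr μ {ω | U ω = z.2} +
          cpr μ {ω | V ω = z.1} {ω | U ω = z.2}) := by
        refine Finset.sum_lt_sum (fun z _ => ?_) ⟨z₀, Finset.mem_univ _, hlt z₀ hz₀⟩
        rcases (pr_nonneg μ {ω | (V ω, U ω) = z}).eq_or_lt with hz | hz
        · rw [← hz, ite_self]
          exact mul_nonneg h2.le (add_nonneg (mul_nonneg (pr_nonneg _ _) (pr_nonneg _ _))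
            (div_nonneg (pr_nonneg _ _) (pr_nonneg _ _)))
        · exact (hlt z hz).le
    _ = 2 ^ (-α) * (1 + ∑ u, ∑ v, cpr μ {ω | V ω = v} {ω | U ω = u}) := by
        rw [← Finset.mul_sum, Finset.sum_add_distrib, Fintype.sum_prod_type,
          Fintype.sum_prod_type_right]
        simp only [← Finset.sum_mul_sum, sum_pr_fiber, one_mul]
    _ ≤ 2 ^ (-α) * (1 + ∑ _u : 𝒰, 1) := by
        gcongr with u
        exact sum_cpr_le_one μ V U u
    _ = ((Fintype.card 𝒰 : ℝ) + 1) * 2 ^ (-α) := by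
        simp
        ring

end Paper
end
end

section
/- Let 𝒳 and 𝒴 be finite sets with |𝒳| ≥ 2 and |𝒴| ≥ 2, let n ≥ 2, let w, w̃ ∈ 𝒫(𝒴|𝒳), and let Q be a probability mass function on 𝒳^n. Define the mixtures w_n(𝐲) = Σ_{𝐱∈𝒳^n} w^n(𝐲|𝐱)·Q(𝐱) and w̃_n(𝐲) = Σ_{𝐱∈𝒳^n} w̃^n(𝐲|𝐱)·Q(𝐱). Then for every 𝐲 ∈ 𝒴^n with w̃_n(𝐲) > 0: log₂( w_n(𝐲) / w̃_n(𝐲) ) ≤ n·sup{ D_{ŵ}(w‖w̃|p̂) : ŵ ∈ 𝒫(𝒴|𝒳), p̂ a probability mass function on 𝒳 } + 2|𝒳||𝒴|·log₂ n. -/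
open scoped Classical BigOperators

noncomputable section

namespace Paper

variable {Ω : Type*}

/-- The deterministic channel with constant output `y₀`. -/
def Channel.const (𝒳 : Type*) {𝒴 : Type*} [Fintype 𝒴] (y₀ : 𝒴) : Channel 𝒳 𝒴 where
  w _ y := if y = y₀ then 1 else 0
  nonneg _ y := by split_ifs <;> norm_num
  sum_one _ := by simp

section

variable {𝒳 𝒴 : Type*} [Fintype 𝒴] (w w' : Channel 𝒳 𝒴)

lemma const_mul_point_pos_iff (x₀ x : 𝒳) (y₀ y : 𝒴) :
    0 < (Channel.const 𝒳 y₀).w x y * (if x = x₀ then (1 : ℝ) else 0) ↔ x = x₀ ∧ y = y₀ := by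
  by_cases hx : x = x₀ <;> by_cases hy : y = y₀ <;> simp [Channel.const, hx, hy]

lemma Channel.exists_pos_of_le (x : 𝒳) : ∃ y, 0 < w.w x y ∧ w'.w x y ≤ w.w x y := by
  by_contra! h
  obtain ⟨y₀, -, hy₀⟩ : ∃ y ∈ Finset.univ, 0 < w.w x y := by
    apply Finset.exists_lt_of_sum_lt
    simp [w.sum_one x]
  have hlt : ∑ y, w.w x y < ∑ y, w'.w x y := by
    refine Finset.sum_lt_sum (fun y _ => ?_) ⟨y₀, Finset.mem_univ _, h y₀ hy₀⟩
    rcases (w.nonneg x y).eq_or_lt with h0 | h0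
    · rw [← h0]
      exact w'.nonneg x y
    · exact (h y h0).le
  rw [w.sum_one, w'.sum_one] at hlt
  exact lt_irrefl _ hlt

variable [Fintype 𝒳]

lemma Dkl_const_le_DklSup (x₀ : 𝒳) (y₀ : 𝒴) :
    Dkl w w' (Channel.const 𝒳 y₀) (fun x => if x = x₀ then 1 else 0) ≤ DklSup w w' :=
  le_sSup ⟨_, _, fun x => by split_ifs <;> norm_num, by simp, rfl⟩

lemma DklSup_eq_top {x₀ : 𝒳} {y₀ : 𝒴} (hw : 0 < w.w x₀ y₀) (hw' : w'.w x₀ y₀ = 0) :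
    DklSup w w' = ⊤ := by
  have h := Dkl_const_le_DklSup w w' x₀ y₀
  rw [Dkl, if_pos ⟨x₀, y₀, (const_mul_point_pos_iff x₀ x₀ y₀ y₀).2 ⟨rfl, rfl⟩, hw', hw⟩] at h
  exact top_le_iff.1 h

lemma logb_div_le_DklSup {x₀ : 𝒳} {y₀ : 𝒴} (hw : 0 < w.w x₀ y₀) (hw' : 0 < w'.w x₀ y₀) :
    ((Real.logb 2 (w.w x₀ y₀ / w'.w x₀ y₀) : ℝ) : EReal) ≤ DklSup w w' := by
  have h := Dkl_const_le_DklSup w w' x₀ y₀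
  simp only [Dkl, const_mul_point_pos_iff] at h
  rw [if_neg, if_neg] at h
  · simpa [Channel.const] using h
  · rintro ⟨x, y, ⟨rfl, rfl⟩, h0, -⟩
    exact hw.ne' h0
  · rintro ⟨x, y, ⟨rfl, rfl⟩, h0, -⟩
    exact hw'.ne' h0

lemma DklSup_nonneg [Nonempty 𝒳] : 0 ≤ DklSup w w' := by
  obtain ⟨y, hw, hle⟩ := Channel.exists_pos_of_le w w' (Classical.arbitrary 𝒳)
  rcases (w'.nonneg _ y).eq_or_lt with h0 | h0
  · rw [DklSup_eq_top w w' hw h0.symm]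
    exact le_top
  · refine le_trans ?_ (logb_div_le_DklSup w w' hw h0)
    exact_mod_cast Real.logb_nonneg one_lt_two ((one_le_div h0).2 hle)

lemma Channel.le_two_rpow_mul {S : ℝ} (hS : DklSup w w' = S) (x : 𝒳) (y : 𝒴) :
    w.w x y ≤ 2 ^ S * w'.w x y := by
  rcases (w.nonneg x y).eq_or_lt with hw | hw
  · rw [← hw]
    exact mul_nonneg (by positivity) (w'.nonneg x y)
  rcases (w'.nonneg x y).eq_or_lt with hw' | hw'
  · exact absurd (hS.symm.trans (DklSup_eq_top w w' hw hw'.symm)) (EReal.coe_ne_top S)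
  have h := logb_div_le_DklSup w w' hw hw'
  rw [hS, EReal.coe_le_coe_iff, Real.logb_le_iff_le_rpow one_lt_two (div_pos hw hw'),
    div_le_iff₀ hw'] at h
  exact h

lemma Channel.pn_le_two_rpow_mul {S : ℝ} (hS : DklSup w w' = S) (n : ℕ)
    (x : Fin n → 𝒳) (y : Fin n → 𝒴) : w.pn n x y ≤ 2 ^ (n * S) * w'.pn n x y := by
  calc w.pn n x y ≤ ∏ i, 2 ^ S * w'.w (x i) (y i) :=
        Finset.prod_le_prod (fun i _ => w.nonneg _ _)
          fun i _ => Channel.le_two_rpow_mul w w' hS _ _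
    _ = 2 ^ (n * S) * w'.pn n x y := by
        rw [Finset.prod_mul_distrib, Finset.prod_const, Finset.card_univ, Fintype.card_fin,
          mul_comm (n : ℝ) S, Real.rpow_mul_natCast two_pos.le, Channel.pn]

end

/-- Lemma `olalt`. -/
theorem mixture_log_ratio_bound
    (𝒳 𝒴 : Type) [Fintype 𝒳] [Fintype 𝒴]
    (hX : 2 ≤ Fintype.card 𝒳) (hY : 2 ≤ Fintype.card 𝒴)
    (n : ℕ) (hn : 2 ≤ n) (w w' : Channel 𝒳 𝒴)
    (Q : (Fin n → 𝒳) → ℝ) (hQ0 : ∀ x, 0 ≤ Q x) (hQ1 : ∑ x, Q x = 1) :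
    ∀ y : Fin n → 𝒴, 0 < ∑ x, w'.pn n x y * Q x →
      ((Real.logb 2 ((∑ x, w.pn n x y * Q x) / (∑ x, w'.pn n x y * Q x)) : ℝ) : EReal) ≤
        ((n : ℝ) : EReal) * DklSup w w' +
          ((2 * (Fintype.card 𝒳) * (Fintype.card 𝒴) * Real.logb 2 n : ℝ) : EReal) := by
  intro y hpos
  have hlog : 0 ≤ 2 * (Fintype.card 𝒳) * (Fintype.card 𝒴) * Real.logb 2 n :=
    mul_nonneg (by positivity) (Real.logb_nonneg one_lt_two (by exact_mod_cast by lia))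
  have : Nonempty 𝒳 := Fintype.card_pos_iff.1 (by lia)
  have hS0 := DklSup_nonneg w w'
  by_cases htop : DklSup w w' = ⊤
  · rw [htop, EReal.coe_mul_top_of_pos (by exact_mod_cast by lia), EReal.top_add_coe]
    exact le_top
  lift DklSup w w' to ℝ using ⟨htop, ne_bot_of_le_ne_bot EReal.zero_ne_bot hS0⟩ with S hS
  rw [EReal.coe_nonneg] at hS0
  rw [← EReal.coe_mul, ← EReal.coe_add, EReal.coe_le_coe_iff]
  refine le_add_of_le_of_nonneg ?_ hlog
  have hle : ∑ x, w.pn n x y * Q x ≤ 2 ^ (n * S) * ∑ x, w'.pn n x y * Q x := by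
    rw [Finset.mul_sum]
    refine Finset.sum_le_sum fun x _ => ?_
    rw [← mul_assoc]
    exact mul_le_mul_of_nonneg_right (Channel.pn_le_two_rpow_mul w w' hS.symm n x y) (hQ0 x)
  have hnonneg : 0 ≤ ∑ x, w.pn n x y * Q x :=
    Finset.sum_nonneg fun x _ =>
      mul_nonneg (Finset.prod_nonneg fun i _ => w.nonneg _ _) (hQ0 x)
  rcases hnonneg.eq_or_lt with h0 | h0
  · rw [← h0, zero_div, Real.logb_zero]
    positivity
  · rwa [Real.logb_le_iff_le_rpow one_lt_two (div_pos h0 hpos), div_le_iff₀ hpos]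

end Paper
end
end
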